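/- Let T > 0. Let v : [0,T]×ℝ³ → ℝ³ be jointly smooth with v(t,·) divergence-free for each t, with cylindrical components v_r, v_θ, v_z. Let ℋ : [0,T]×ℝ³ → ℝ be jointly smooth, axisymmetric in x for each t, with supp ℋ(t,·) contained in a fixed compact set K ⊂ U for all t, and suppose the equation ∂_t ℋ + v_r ∂_r ℋ + v_z ∂_z ℋ − ℋ·(1/r)∂_θ v_θ − 2ℋ∂_z ℋ = 0 holds on [0,T]×U. Then for every p ∈ [2,∞) and every t ∈ [0,T]: ‖ℋ(t,·)‖_{L^p(ℝ³)} = ‖ℋ(0,·)‖_{L^p(ℝ³)}. -/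

import Mathlib

open MeasureTheory

noncomputable section

abbrev R3 : Type := Fin 3 → ℝ

/-- cylindrical radius `r(x) = √(x₁² + x₂²)` -/
def rr (x : R3) : ℝ := Real.sqrt (x 0 ^ 2 + x 1 ^ 2)

/-- the region off the symmetry axis -/
def U : Set R3 := {x | 0 < rr x}

/-- partial derivative in coordinate direction `i` -/
def pd (i : Fin 3) (u : R3 → ℝ) : R3 → ℝ := fun x => fderiv ℝ u x (Pi.single i 1)

/-- angular derivative `∂_θ u = x₁ ∂₂ u − x₂ ∂₁ u` -/
def dTheta (u : R3 → ℝ) : R3 → ℝ := fun x => x 0 * pd 1 u x - x 1 * pd 0 u x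

/-- radial derivative `∂_r u = (x₁ ∂₁ u + x₂ ∂₂ u)/r` -/
def dR (u : R3 → ℝ) : R3 → ℝ := fun x => (x 0 * pd 0 u x + x 1 * pd 1 u x) / rr x

/-- vertical derivative `∂_z` -/
def dZ (u : R3 → ℝ) : R3 → ℝ := pd 2 u

/-- the operator `(1/r)∂_r` -/
def dRr (u : R3 → ℝ) : R3 → ℝ := fun x => dR u x / rr x

/-- axisymmetric: `∂_θ f = 0` on `U` -/
def axisym (f : R3 → ℝ) : Prop := ∀ x ∈ U, dTheta f x = 0

/-- radial unit vector -/
def er (x : R3) : R3 := ![x 0 / rr x, x 1 / rr x, 0]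
/-- azimuthal unit vector -/
def etheta (x : R3) : R3 := ![-(x 1) / rr x, x 0 / rr x, 0]
/-- vertical unit vector -/
def ez : R3 := ![0, 0, 1]

/-- Euclidean dot product on `ℝ³` -/
def dot (a b : R3) : ℝ := ∑ j : Fin 3, a j * b j

/-- radial cylindrical component `u_r = u · e_r` -/
def compR (u : R3 → R3) : R3 → ℝ := fun y => dot (u y) (er y)
/-- azimuthal cylindrical component `u_θ = u · e_θ` -/
def compTh (u : R3 → R3) : R3 → ℝ := fun y => dot (u y) (etheta y)
/-- vertical cylindrical component `u_z = u · e_z` -/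
def compZ (u : R3 → R3) : R3 → ℝ := fun y => dot (u y) ez

/-- divergence-free vector field -/
def divFree (u : R3 → R3) : Prop := ∀ x : R3, (∑ i : Fin 3, pd i (fun y => u y i) x) = 0

lemma int_pd (i : Fin 3) (f : R3 → ℝ) (hf : ContDiff ℝ 1 f) (hc : HasCompactSupport f) :
    Integrable (pd i f) ∧ ∫ x, pd i f x = 0 := by
  have h1 : Continuous (fun x => fderiv ℝ f x (Pi.single i 1)) :=
    (hf.continuous_fderiv one_ne_zero).clm_apply continuous_const
  have h2 : HasCompactSupport (fun x => fderiv ℝ f x (Pi.single i 1)) :=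
    hc.fderiv_apply ℝ (Pi.single i 1)
  have h3 := h1.integrable_of_hasCompactSupport (μ := volume) h2
  refine ⟨h3, ?_⟩
  have h4 := hf.continuous.integrable_of_hasCompactSupport (μ := volume) hc
  have := integral_mul_fderiv_eq_neg_fderiv_mul_of_integrable (𝕜 := ℝ) (μ := (volume : Measure R3))
    (f := f) (g := fun _ => (1 : ℝ)) (v := Pi.single i 1)
    (by simpa using h3) (by simp) (by simpa using h4)
    (fun x _ => (hf.differentiable one_ne_zero) x) (fun x _ => differentiableAt_const _)
  simp only [fderiv_fun_const, Pi.zero_apply, mul_one] at this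
  simp at this
  simpa [pd] using this

lemma pd_mul (i : Fin 3) (f g : R3 → ℝ) (x : R3) (hf : DifferentiableAt ℝ f x)
    (hg : DifferentiableAt ℝ g x) :
    pd i (fun y => f y * g y) x = pd i f x * g x + f x * pd i g x := by
  unfold pd
  rw [fderiv_fun_mul hf hg]
  simp; ring

lemma pd_coord (i j : Fin 3) (x : R3) :
    pd i (fun y => y j) x = if j = i then 1 else 0 := by
  unfold pd
  have : HasFDerivAt (fun y : R3 => y j) (ContinuousLinearMap.proj (R := ℝ) (φ := fun _ : Fin 3 => ℝ) j) x :=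
    hasFDerivAt_apply j x
  rw [this.fderiv]
  simp [Pi.single_apply]

lemma pd_comp (i : Fin 3) (g : ℝ → ℝ) (g' : ℝ) (f : R3 → ℝ) (x : R3)
    (hg : HasDerivAt g g' (f x)) (hf : DifferentiableAt ℝ f x) :
    pd i (fun y => g (f y)) x = g' * pd i f x := by
  unfold pd
  have := hg.comp_hasFDerivAt x hf.hasFDerivAt
  have h2 := this.fderiv
  have h3 : (g ∘ f) = fun y => g (f y) := rfl
  rw [h3] at h2
  rw [h2]
  simp

lemma rr_contDiffAt (x : R3) (hx : x ∈ U) : ContDiffAt ℝ 1 rr x := by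
  have h : x 0 ^ 2 + x 1 ^ 2 ≠ 0 := (Real.sqrt_pos.1 hx).ne'
  unfold rr
  exact ContDiffAt.sqrt (by fun_prop) h

lemma rr_sq (x : R3) : rr x ^ 2 = x 0 ^ 2 + x 1 ^ 2 := by
  unfold rr
  exact Real.sq_sqrt (by positivity)

lemma pd_rr (i : Fin 3) (x : R3) (hx : x ∈ U) :
    2 * rr x * pd i rr x = 2 * x 0 * pd i (fun y => y 0) x + 2 * x 1 * pd i (fun y => y 1) x := by
  have hd := (rr_contDiffAt x hx).differentiableAt one_ne_zero
  have h1 := pd_mul i rr rr x hd hd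
  have h2 : (fun y => rr y * rr y) = fun y : R3 => y 0 * y 0 + y 1 * y 1 := by
    funext y
    have := rr_sq y
    nlinarith
  have e0 : DifferentiableAt ℝ (fun y : R3 => y 0) x := by fun_prop
  have e1 : DifferentiableAt ℝ (fun y : R3 => y 1) x := by fun_prop
  have h3 : pd i (fun y : R3 => y 0 * y 0 + y 1 * y 1) x
      = pd i (fun y : R3 => y 0 * y 0) x + pd i (fun y : R3 => y 1 * y 1) x := by
    unfold pd
    rw [fderiv_fun_add (e0.fun_mul e0) (e1.fun_mul e1)]
    simp
  rw [h2, h3, pd_mul i _ _ x e0 e0, pd_mul i _ _ x e1 e1] at h1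
  linarith

lemma dTheta_rr_inv (x : R3) (hx : x ∈ U) : dTheta (fun y => (rr y)⁻¹) x = 0 := by
  have hd := (rr_contDiffAt x hx).differentiableAt one_ne_zero
  have hr : rr x ≠ 0 := ne_of_gt hx
  have h := fun i => pd_comp i (fun s => s⁻¹) _ rr x (hasDerivAt_inv hr) hd
  unfold dTheta
  rw [h, h]
  have h0 := pd_rr 0 x hx
  have h1 := pd_rr 1 x hx
  simp only [pd_coord] at h0 h1
  norm_num at h0 h1
  have h0' : pd 0 rr x = x 0 / rr x := by field_simp; linarith
  have h1' : pd 1 rr x = x 1 / rr x := by field_simp; linarith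
  rw [h0', h1']; ring

lemma spatial (w : R3 → R3) (hw : ContDiff ℝ 1 w) (hdiv : divFree w) (h : R3 → ℝ)
    (hh : ContDiff ℝ 1 h) (hax : axisym h) (K : Set R3) (hK : IsCompact K) (hKU : K ⊆ U)
    (hsupp : ∀ x ∉ K, h x = 0) (d : R3 → ℝ)
    (heq : ∀ x ∈ U, d x + compR w x * dR h x + compZ w x * dZ h x
        - h x * (dTheta (compTh w) x / rr x) - 2 * h x * dZ h x = 0) (p : ℝ) (hp : 2 ≤ p) :
    ∫ x, p * |h x| ^ (p - 2) * h x * d x = 0 := by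
  have hp1 : 1 < p := by linarith
  have hp0 : p ≠ 0 := by linarith
  set F : R3 → ℝ := fun x => |h x| ^ p with hF
  have hFc : ContDiff ℝ 1 F := (contDiff_norm_rpow (E := ℝ) hp1).comp hh
  have hF0 : ∀ x ∉ K, F x = 0 := fun x hx => by simp [hF, hsupp x hx, hp0]
  have hcs : ∀ f : R3 → ℝ, (∀ x ∉ K, f x = 0) → HasCompactSupport f := fun f hf =>
    HasCompactSupport.intro hK hf
  have hloc : ∀ f : R3 → ℝ, (∀ x ∉ K, f x = 0) → ∀ x ∉ K, f =ᶠ[nhds x] fun _ => 0 := by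
    intro f hf x hx
    filter_upwards [hK.isClosed.isOpen_compl.mem_nhds hx] with y hy using hf y hy
  have hpd0 : ∀ f : R3 → ℝ, (∀ x ∉ K, f x = 0) → ∀ i, ∀ x ∉ K, pd i f x = 0 := by
    intro f hf i x hx
    unfold pd
    rw [(hloc f hf x hx).fderiv_eq]
    simp
  have hwi : ∀ i, ContDiff ℝ 1 (fun y => w y i) := fun i => by fun_prop
  have hcT : ∀ x ∈ U, ContDiffAt ℝ 1 (compTh w) x := by
    intro x hx
    have hr := rr_contDiffAt x hx
    have hr0 : rr x ≠ 0 := ne_of_gt hx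
    have e : compTh w = fun y => w y 0 * (-(y 1) / rr y) + w y 1 * (y 0 / rr y) := by
      funext y
      simp [compTh, dot, etheta, Fin.sum_univ_three]
    rw [e]
    have w0 := (hwi 0).contDiffAt (x := x)
    have w1 := (hwi 1).contDiffAt (x := x)
    have c0 : ContDiffAt ℝ 1 (fun y : R3 => y 0) x := by fun_prop
    have c1 : ContDiffAt ℝ 1 (fun y : R3 => y 1) x := by fun_prop
    exact (w0.mul (c1.neg.div hr hr0)).add (w1.mul (c0.div hr hr0))
  have hri : ∀ x ∈ U, ContDiffAt ℝ 1 (fun y => (rr y)⁻¹) x := fun x hx =>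
    (rr_contDiffAt x hx).inv (ne_of_gt hx)
  set Q : R3 → ℝ := fun y => F y * (compTh w y * (rr y)⁻¹) with hQ
  have hQ0 : ∀ x ∉ K, Q x = 0 := fun x hx => by simp [hQ, hF0 x hx]
  have hQc : ContDiff ℝ 1 Q := by
    rw [contDiff_iff_contDiffAt]
    intro x
    by_cases hx : x ∈ K
    · exact hFc.contDiffAt.mul ((hcT x (hKU hx)).mul (hri x (hKU hx)))
    · exact contDiffAt_const.congr_of_eventuallyEq (hloc Q hQ0 x hx)
  set G : R3 → ℝ := fun y => F y * h y with hG
  have hGc : ContDiff ℝ 1 G := hFc.mul hh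
  have hG0 : ∀ x ∉ K, G x = 0 := fun x hx => by simp [hG, hF0 x hx]
  have hWc : ∀ i, ContDiff ℝ 1 (fun y => w y i * F y) := fun i => (hwi i).mul hFc
  have hW0 : ∀ i, ∀ x ∉ K, w x i * F x = 0 := fun i x hx => by simp [hF0 x hx]
  have hQic : ∀ j : Fin 3, ContDiff ℝ 1 (fun y => y j * Q y) := fun j =>
    ContDiff.mul (by fun_prop) hQc
  have hQi0 : ∀ j : Fin 3, ∀ x ∉ K, x j * Q x = 0 := fun j x hx => by simp [hQ0 x hx]
  have key : ∀ x, p * |h x| ^ (p - 2) * h x * d x =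
      -(pd 0 (fun y => w y 0 * F y) x + pd 1 (fun y => w y 1 * F y) x
          + pd 2 (fun y => w y 2 * F y) x)
      + p * (pd 1 (fun y => y 0 * Q y) x - pd 0 (fun y => y 1 * Q y) x)
      + 2 * p / (p + 1) * pd 2 G x := by
    intro x
    by_cases hx : x ∈ K
    swap
    · rw [hpd0 _ (hW0 0) _ x hx, hpd0 _ (hW0 1) _ x hx, hpd0 _ (hW0 2) _ x hx,
        hpd0 _ (hQi0 0) _ x hx, hpd0 _ (hQi0 1) _ x hx, hpd0 _ hG0 _ x hx, hsupp x hx]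
      simp
    have hxU := hKU hx
    have hr0 : rr x ≠ 0 := ne_of_gt hxU
    have dh := hh.differentiable one_ne_zero x
    have dF := hFc.differentiable one_ne_zero x
    have dQ := hQc.differentiable one_ne_zero x
    have dw := fun i => (hwi i).differentiable one_ne_zero x
    have dT := (hcT x hxU).differentiableAt one_ne_zero
    have dI := (hri x hxU).differentiableAt one_ne_zero
    have dx := fun j : Fin 3 => (by fun_prop : DifferentiableAt ℝ (fun y : R3 => y j) x)
    have pF : ∀ i, pd i F x = (p * |h x| ^ (p - 2) * h x) * pd i h x := fun i =>
      pd_comp i (fun s => |s| ^ p) _ h x (hasDerivAt_abs_rpow (h x) hp1) dh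
    have pQ : ∀ i, pd i Q x = pd i F x * (compTh w x * (rr x)⁻¹)
        + F x * (pd i (compTh w) x * (rr x)⁻¹ + compTh w x * pd i (fun y => (rr y)⁻¹) x) := by
      intro i
      rw [hQ, pd_mul i F _ x dF (dT.fun_mul dI), pd_mul i (compTh w) _ x dT dI]
    have hDF : (p * |h x| ^ (p - 2) * h x) * h x = p * F x := by
      have : |h x| ^ p = |h x| ^ (p - 2) * |h x| ^ 2 := by
        by_cases h0 : h x = 0
        · simp [h0, hp0]
        · rw [← Real.rpow_natCast, ← Real.rpow_add (abs_pos.2 h0)]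
          congr 1; push_cast; ring
      simp only [hF]
      rw [this, sq_abs]; ring
    rw [pd_mul 0 _ F x (dw 0) dF, pd_mul 1 _ F x (dw 1) dF, pd_mul 2 _ F x (dw 2) dF,
      pd_mul 1 _ Q x (dx 0) dQ, pd_mul 0 _ Q x (dx 1) dQ, hG, pd_mul 2 F h x dF dh,
      pQ, pQ, pF, pF, pF, pd_coord, pd_coord]
    have ha := hax x hxU
    have hi := dTheta_rr_inv x hxU
    have hdv := hdiv x
    have he := heq x hxU
    have hrs := rr_sq x
    simp only [dTheta, dR, dZ, Fin.sum_univ_three] at ha hi hdv he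
    have hR : compR w x * ((x 0 * pd 0 h x + x 1 * pd 1 h x) / rr x)
        = w x 0 * pd 0 h x + w x 1 * pd 1 h x := by
      simp only [compR, dot, er, Fin.sum_univ_three]
      simp
      field_simp
      rw [hrs]
      linear_combination (x 1 * w x 0 - x 0 * w x 1) * ha
    have hZ : compZ w x = w x 2 := by simp [compZ, dot, ez, Fin.sum_univ_three]
    rw [hR, hZ] at he
    set D := p * |h x| ^ (p - 2) * h x
    have hp1' : p + 1 ≠ 0 := by linarith
    have hGG : 2 * p / (p + 1) * (D * pd 2 h x * h x + F x * pd 2 h x) = 2 * p * F x * pd 2 h x := by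
      have e : D * pd 2 h x * h x + F x * pd 2 h x = (p + 1) * (F x * pd 2 h x) := by
        linear_combination pd 2 h x * hDF
      rw [e, ← mul_assoc, div_mul_cancel₀ _ hp1']
      ring
    rw [hGG]
    norm_num
    rw [div_eq_mul_inv] at he
    linear_combination D * he + F x * hdv - p * F x * compTh w x * hi
      - p * D * compTh w x * (rr x)⁻¹ * ha
      + ((x 0 * pd 1 (compTh w) x - x 1 * pd 0 (compTh w) x) * (rr x)⁻¹ + 2 * pd 2 h x) * hDF
  have i0 := int_pd 0 _ (hWc 0) (hcs _ (hW0 0))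
  have i1 := int_pd 1 _ (hWc 1) (hcs _ (hW0 1))
  have i2 := int_pd 2 _ (hWc 2) (hcs _ (hW0 2))
  have i3 := int_pd 1 _ (hQic 0) (hcs _ (hQi0 0))
  have i4 := int_pd 0 _ (hQic 1) (hcs _ (hQi0 1))
  have i5 := int_pd 2 _ hGc (hcs _ hG0)
  simp_rw [key]
  rw [integral_add, integral_add, integral_neg, integral_add, integral_add, integral_const_mul,
    integral_const_mul, integral_sub, i0.2, i1.2, i2.2, i3.2, i4.2, i5.2]
  · simp
  · exact i3.1
  · exact i4.1
  · exact i0.1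
  · exact i1.1
  · exact i0.1.add i1.1
  · exact i2.1
  · exact ((i0.1.add i1.1).add i2.1).neg
  · exact (i3.1.sub i4.1).const_mul _
  · exact ((i0.1.add i1.1).add i2.1).neg.add ((i3.1.sub i4.1).const_mul _)
  · exact i5.1.const_mul _

lemma timeDeriv (K : Set R3) (hK : IsCompact K) (F F' : ℝ → R3 → ℝ)
    (hF : Continuous (fun q : ℝ × R3 => F q.1 q.2))
    (hF' : Continuous (fun q : ℝ × R3 => F' q.1 q.2))
    (hd : ∀ t x, HasDerivAt (fun s => F s x) (F' t x) t) (t : ℝ) :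
    HasDerivAt (fun s => ∫ x in K, F s x) (∫ x in K, F' t x) t := by
  have hc : ∀ s, Continuous (F s) := fun s => hF.comp (Continuous.prodMk_right s)
  have hc' : ∀ s, Continuous (F' s) := fun s => hF'.comp (Continuous.prodMk_right s)
  obtain ⟨C, hC⟩ := ((isCompact_Icc (a := t - 1) (b := t + 1)).prod hK).exists_bound_of_continuousOn
    hF'.continuousOn
  have : IsFiniteMeasure (volume.restrict K) := ⟨by simpa using hK.measure_lt_top⟩
  refine (hasDerivAt_integral_of_dominated_loc_of_deriv_le (F := F) (F' := F')
    (bound := fun _ => C) (s := Set.Icc (t - 1) (t + 1))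
    (Icc_mem_nhds (by linarith) (by linarith))
    (Filter.Eventually.of_forall fun s => (hc s).aestronglyMeasurable)
    ((hc t).continuousOn.integrableOn_compact hK) (hc' t).aestronglyMeasurable
    ?_ (integrable_const C) (Filter.Eventually.of_forall fun x s _ => hd s x)).2
  filter_upwards [ae_restrict_mem hK.measurableSet] with x hx s hs
  exact hC (s, x) ⟨hs, hx⟩

/-- `L^p` (2 ≤ p < ∞) conservation of the good unknown `ℋ`. -/
theorem stmt_14 (T : ℝ) (hT : 0 < T) (v : ℝ → R3 → R3)
    (hv : ContDiff ℝ (⊤ : ℕ∞) (fun p : ℝ × R3 => v p.1 p.2))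
    (hdiv : ∀ t ∈ Set.Icc (0 : ℝ) T, divFree (v t))
    (H : ℝ → R3 → ℝ)
    (hH : ContDiff ℝ (⊤ : ℕ∞) (fun p : ℝ × R3 => H p.1 p.2))
    (hax : ∀ t ∈ Set.Icc (0 : ℝ) T, axisym (H t))
    (K : Set R3) (hK : IsCompact K) (hKU : K ⊆ U)
    (hsupp : ∀ t ∈ Set.Icc (0 : ℝ) T, ∀ x ∉ K, H t x = 0)
    (heq : ∀ t ∈ Set.Icc (0 : ℝ) T, ∀ x ∈ U,
      deriv (fun s => H s x) t
        + compR (v t) x * dR (H t) x + compZ (v t) x * dZ (H t) x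
        - H t x * (dTheta (compTh (v t)) x / rr x)
        - 2 * H t x * dZ (H t) x = 0) :
    ∀ p : ℝ, 2 ≤ p → ∀ t ∈ Set.Icc (0 : ℝ) T,
      eLpNorm (H t) (ENNReal.ofReal p) volume = eLpNorm (H 0) (ENNReal.ofReal p) volume := by
  intro p hp
  have hp1 : 1 < p := by linarith
  have hp0 : p ≠ 0 := by linarith
  have hH1 : ContDiff ℝ 1 (fun q : ℝ × R3 => H q.1 q.2) :=
    hH.of_le (by exact_mod_cast le_top)
  have hv1 : ContDiff ℝ 1 (fun q : ℝ × R3 => v q.1 q.2) :=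
    hv.of_le (by exact_mod_cast le_top)
  have hHt : ∀ t, ContDiff ℝ 1 (H t) := fun t => hH1.comp (contDiff_prodMk_right t)
  have hvt : ∀ t, ContDiff ℝ 1 (v t) := fun t => hv1.comp (contDiff_prodMk_right t)
  have hHd : ∀ t x, HasDerivAt (fun s => H s x)
      (fderiv ℝ (fun q : ℝ × R3 => H q.1 q.2) (t, x) (1, 0)) t := by
    intro t x
    have h1 := (hH1.differentiable one_ne_zero (t, x)).hasFDerivAt
    have h2 : HasDerivAt (fun s : ℝ => (s, x)) ((1 : ℝ), (0 : R3)) t :=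
      (hasDerivAt_id t).prodMk (hasDerivAt_const t x)
    exact h1.comp_hasDerivAt t h2
  set d : ℝ → R3 → ℝ := fun t x => fderiv ℝ (fun q : ℝ × R3 => H q.1 q.2) (t, x) (1, 0) with hd
  have hdc : Continuous (fun q : ℝ × R3 => d q.1 q.2) :=
    (hH1.continuous_fderiv one_ne_zero).clm_apply continuous_const
  have hcp : Continuous (fun s : ℝ => |s| ^ (p - 2)) :=
    continuous_abs.rpow_const (fun _ => Or.inr (by linarith))
  have hI := fun t => timeDeriv K hK (fun t x => |H t x| ^ p)
    (fun t x => p * |H t x| ^ (p - 2) * H t x * d t x)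
    (hH1.continuous.abs.rpow_const (fun _ => Or.inr (by linarith)))
    (((continuous_const.mul (hcp.comp hH1.continuous)).mul hH1.continuous).mul hdc)
    (fun t x => HasDerivAt.comp (h₂ := fun s : ℝ => |s| ^ p) t (hasDerivAt_abs_rpow (H t x) hp1) (hHd t x)) t
  have hz : ∀ t ∈ Set.Icc (0 : ℝ) T,
      ∫ x in K, p * |H t x| ^ (p - 2) * H t x * d t x = 0 := by
    intro t ht
    rw [setIntegral_eq_integral_of_forall_compl_eq_zero
      (fun x hx => by simp [hsupp t ht x hx])]
    refine spatial (v t) (hvt t) (hdiv t ht) (H t) (hHt t) (hax t ht) K hK hKU (hsupp t ht)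
      (d t) ?_ p hp
    intro x hx
    have := heq t ht x hx
    rwa [(hHd t x).deriv] at this
  have hconst : ∀ t ∈ Set.Icc (0 : ℝ) T, ∫ x in K, |H t x| ^ p = ∫ x in K, |H 0 x| ^ p := by
    refine constant_of_has_deriv_right_zero (f := fun t => ∫ x in K, |H t x| ^ p)
      (fun t _ => (hI t).continuousAt.continuousWithinAt) ?_
    intro t ht
    have := (hI t).hasDerivWithinAt (s := Set.Ici t)
    rwa [hz t ⟨ht.1, ht.2.le⟩] at this
  have hform : ∀ t ∈ Set.Icc (0 : ℝ) T, eLpNorm (H t) (ENNReal.ofReal p) volume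
      = ENNReal.ofReal ((∫ x in K, |H t x| ^ p) ^ p⁻¹) := by
    intro t ht
    have hm : MemLp (H t) (ENNReal.ofReal p) volume :=
      (hHt t).continuous.memLp_of_hasCompactSupport (HasCompactSupport.intro hK (hsupp t ht))
    rw [hm.eLpNorm_eq_integral_rpow_norm (by simp; linarith) ENNReal.ofReal_ne_top,
      ENNReal.toReal_ofReal (by linarith), setIntegral_eq_integral_of_forall_compl_eq_zero
      (fun x hx => by simp [hsupp t ht x hx, hp0])]
    rfl
  intro t ht
  rw [hform t ht, hform 0 ⟨le_rfl, hT.le⟩, hconst t ht]
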